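/- Let d ≥ 2 and let γ(t) = (t, t², …, t^d). There exist constants c > 0 and C > 0 depending only on d with the following property. Let M ≥ 1 be real, let s₁ ≥ 0 and s₂ ≥ 1 be integers, let ξ ∈ ℝ^d, let I ⊆ [0,1] be an interval, and let 2 ≤ k₀ ≤ d be an integer such that: (i) |⟨γ^{(k₀)}(t), ξ⟩| ≥ M·2^{s₁ + (s₂−1)(k₀−1)} for all t ∈ I; (ii) |⟨γ^{(k)}(t), ξ⟩| ≤ M·2^{s₁ + (s₂−1)(k−1)} for all t ∈ I and all 2 ≤ k < k₀. Let t_I ∈ I be a point at which t ↦ |⟨γ^{(1)}(t), ξ⟩| attains its minimum over I. Then every t ∈ I with |t − t_I| ≥ C·2^{−s₂} satisfies |⟨γ^{(1)}(t), ξ⟩| ≥ c·M·2^{s₁+s₂}·|t − t_I|. -/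

import Mathlib

open MeasureTheory ENNReal

/-- The `k`-th derivative of the moment curve `γ(t) = (t, t², …, t^d)`: its `i`-th component
(indexing components by `i : Fin d`, so that component `i` of `γ` is `t^(i+1)`) is
`(i+1)!/(i+1-k)! · t^(i+1-k)` when `k ≤ i+1`, and `0` otherwise. -/
noncomputable def gammaDeriv (d k : ℕ) (t : ℝ) : Fin d → ℝ := fun i =>
  if k ≤ i.1 + 1 then (((i.1 + 1).factorial : ℝ) / ((i.1 + 1 - k).factorial : ℝ)) * t ^ (i.1 + 1 - k)
  else 0

theorem hasDerivAt_gammaDeriv (d k : ℕ) (t : ℝ) (i : Fin d) :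
    HasDerivAt (fun s => gammaDeriv d k s i) (gammaDeriv d (k + 1) t i) t := by
  unfold gammaDeriv
  rcases lt_trichotomy k (i.1 + 1) with h | h | h
  · obtain ⟨m, hm⟩ : ∃ m, i.1 + 1 = k + (m + 1) := ⟨i.1 - k, by omega⟩
    have h1 : i.1 + 1 - k = m + 1 := by omega
    have h2 : i.1 + 1 - (k + 1) = m := by omega
    simp only [h1, h2, if_pos h.le, if_pos (Nat.succ_le_of_lt h)]
    refine ((hasDerivAt_pow (m + 1) t).const_mul
      (((i.1 + 1).factorial : ℝ) / ((m + 1).factorial : ℝ))).congr_deriv ?_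
    rw [Nat.factorial_succ m]
    have := Nat.factorial_ne_zero m
    push_cast
    field_simp
  · simp only [← h, le_refl, if_true, Nat.sub_self, pow_zero, Nat.not_succ_le_self, if_false]
    exact hasDerivAt_const t _
  · simp only [if_neg (show ¬ k ≤ i.1 + 1 by omega), if_neg (show ¬ k + 1 ≤ i.1 + 1 by omega)]
    exact hasDerivAt_const t _

theorem hasDerivAt_sum_gammaDeriv (d k : ℕ) (ξ : Fin d → ℝ) (t : ℝ) :
    HasDerivAt (fun s => ∑ i, gammaDeriv d k s i * ξ i)
      (∑ i, gammaDeriv d (k + 1) t i * ξ i) t :=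
  HasDerivAt.fun_sum fun i _ => (hasDerivAt_gammaDeriv d k t i).mul_const (ξ i)

theorem mul_abs_sub_le_abs_image_sub {f f' : ℝ → ℝ} {I : Set ℝ} (hI : I.OrdConnected)
    (hf : ∀ x ∈ I, HasDerivAt f (f' x) x) {m : ℝ} (hm : ∀ x ∈ I, m ≤ |f' x|)
    {a b : ℝ} (ha : a ∈ I) (hb : b ∈ I) : m * |a - b| ≤ |f a - f b| := by
  wlog hab : a < b generalizing a b
  · rcases eq_or_lt_of_le (not_lt.mp hab) with rfl | h
    · simp
    · rw [abs_sub_comm a, abs_sub_comm (f a)]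
      exact this hb ha h
  have hsub : Set.Icc a b ⊆ I := hI.out ha hb
  obtain ⟨x, hx, hfx⟩ := exists_hasDerivAt_eq_slope f f' hab
    (fun x hx => (hf x (hsub hx)).continuousAt.continuousWithinAt)
    (fun x hx => hf x (hsub (Set.Ioo_subset_Icc_self hx)))
  have h : f b - f a = f' x * (b - a) := by
    rw [hfx, div_mul_cancel₀ _ (sub_pos.mpr hab).ne']
  rw [abs_sub_comm a, abs_sub_comm (f a), h, abs_mul]
  exact mul_le_mul_of_nonneg_right (hm x (hsub (Set.Ioo_subset_Icc_self hx))) (abs_nonneg _)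

theorem statement13 (d : ℕ) (hd : 2 ≤ d) :
    ∃ c : ℝ, 0 < c ∧ ∃ C : ℝ, 0 < C ∧
      ∀ (M : ℝ), 1 ≤ M → ∀ (s₁ s₂ : ℕ), 1 ≤ s₂ →
      ∀ (ξ : EuclideanSpace ℝ (Fin d)) (I : Set ℝ), I.OrdConnected → I ⊆ Set.Icc 0 1 →
      ∀ (k₀ : ℕ), 2 ≤ k₀ → k₀ ≤ d →
      (∀ t ∈ I, M * 2 ^ (s₁ + (s₂ - 1) * (k₀ - 1)) ≤ |∑ i, gammaDeriv d k₀ t i * ξ i|) →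
      (∀ t ∈ I, ∀ k : ℕ, 2 ≤ k → k < k₀ →
        |∑ i, gammaDeriv d k t i * ξ i| ≤ M * 2 ^ (s₁ + (s₂ - 1) * (k - 1))) →
      ∀ tI ∈ I,
        (∀ t ∈ I, |∑ i, gammaDeriv d 1 tI i * ξ i| ≤ |∑ i, gammaDeriv d 1 t i * ξ i|) →
      ∀ t ∈ I, C * ((2:ℝ) ^ s₂)⁻¹ ≤ |t - tI| →
        c * M * 2 ^ (s₁ + s₂) * |t - tI| ≤ |∑ i, gammaDeriv d 1 t i * ξ i| := by
  refine ⟨1 / 4, by norm_num, 8, by norm_num, ?_⟩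
  intro M hM s₁ s₂ hs₂ ξ I hI _ k₀ hk₀ _ hlow hup tI htI hmin t ht hdist
  obtain ⟨n, rfl⟩ : ∃ n, s₂ = n + 1 := ⟨s₂ - 1, by omega⟩
  obtain ⟨j, rfl⟩ : ∃ j, k₀ = j + 2 := ⟨k₀ - 2, by omega⟩
  have hmv := mul_abs_sub_le_abs_image_sub hI
    (fun x _ => hasDerivAt_sum_gammaDeriv d (j + 1) ξ x) hlow ht htI
  have htri := abs_sub (∑ i, gammaDeriv d (j + 1) t i * ξ i)
    (∑ i, gammaDeriv d (j + 1) tI i * ξ i)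
  rcases j with _ | j
  · have hle := hmin t ht
    simp only [Nat.add_sub_cancel, zero_add, Nat.reduceSub, mul_one] at hmv htri
    rw [← add_assoc, pow_succ]
    linarith
  · exfalso
    have hk : ∀ x ∈ I, |∑ i, gammaDeriv d (j + 1 + 1) x i * ξ i| ≤
        M * 2 ^ (s₁ + n * (j + 1)) := fun x hx => hup x hx (j + 2) (by omega) (by omega)
    have hpow : M * 2 ^ (s₁ + (n + 1 - 1) * (j + 1 + 2 - 1)) =
        M * 2 ^ (s₁ + n * (j + 1)) * 2 ^ n := by
      rw [mul_assoc, ← pow_add]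
      congr 2
      simp only [Nat.add_sub_cancel, show j + 1 + 2 - 1 = j + 2 by omega]
      ring
    rw [hpow] at hmv
    have hA : 0 < M * 2 ^ (s₁ + n * (j + 1)) := by positivity
    have hfour : (4 : ℝ) ≤ 2 ^ n * |t - tI| := by
      have := mul_le_mul_of_nonneg_left hdist (by positivity : (0 : ℝ) ≤ 2 ^ n)
      calc (4 : ℝ) = 2 ^ n * (8 * (2 ^ (n + 1))⁻¹) := by
            rw [pow_succ]
            field_simp
            norm_num
        _ ≤ _ := this
    have h1 := hk t ht
    have h2 := hk tI htI
    have h3 := mul_le_mul_of_nonneg_left hfour hA.le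
    rw [← mul_assoc] at h3
    linarith
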